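/- arXiv:1205.4839 — 6 statements merged into one kernel-verified Lean document; each statement's English description precedes it below -/
import Mathlib

section
/- (Policy Improvement, pointwise form.) Let S and A be as in the finite MDP setup, let π and π' be policies, let V^{π,γ} be the unique fixed point of T_π, and let Q^{π,γ}(s,a) = Σ_{s'} P(s'|s,a)(R(s,a,s') + γ(s') V^{π,γ}(s')). If Σ_{a} π'(a|s) Q^{π,γ}(s,a) ≥ V^{π,γ}(s) for every state s ∈ S, then V^{π',γ}(s) ≥ V^{π,γ}(s) for every s ∈ S; consequently, for any nonnegative weights d : S → ℝ, Σ_s d(s) V^{π',γ}(s) ≥ Σ_s d(s) V^{π,γ}(s). -/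
/-- A weighted average is bounded by any upper bound of the averaged values. -/
theorem sum_mul_le_of_sum_eq_one {ι : Type*} [Fintype ι] {w f : ι → ℝ} {b : ℝ}
    (hw0 : ∀ i, 0 ≤ w i) (hw1 : ∑ i, w i = 1) (hf : ∀ i, f i ≤ b) :
    ∑ i, w i * f i ≤ b :=
  calc ∑ i, w i * f i ≤ ∑ i, w i * b :=
        Finset.sum_le_sum fun i _ => mul_le_mul_of_nonneg_left (hf i) (hw0 i)
    _ = b := by rw [← Finset.sum_mul, hw1, one_mul]

/-- A function dominated by its discounted one-step expectation is nonpositive. -/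
theorem nonpos_of_le_discounted_expectation {S A : Type*} [Fintype S] [Fintype A]
    {P : S → A → S → ℝ} {γ : S → ℝ} {c : ℝ} {π : S → A → ℝ} {D : S → ℝ}
    (hP0 : ∀ s a s', 0 ≤ P s a s') (hP1 : ∀ s a, ∑ s', P s a s' = 1)
    (hγ0 : ∀ s, 0 ≤ γ s) (hγc : ∀ s, γ s ≤ c) (hc : c < 1)
    (hπ0 : ∀ s a, 0 ≤ π s a) (hπ1 : ∀ s, ∑ a, π s a = 1)
    (hD : ∀ s, D s ≤ ∑ a, π s a * ∑ s', P s a s' * (γ s' * D s')) (s : S) :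
    D s ≤ 0 := by
  have : Nonempty S := ⟨s⟩
  obtain ⟨m, hm⟩ := Finite.exists_max D
  refine (hm s).trans ?_
  by_contra! hpos
  have hle : D m ≤ c * D m := (hD m).trans <|
    sum_mul_le_of_sum_eq_one (hπ0 m) (hπ1 m) fun a =>
      sum_mul_le_of_sum_eq_one (hP0 m a) (hP1 m a) fun s' =>
        (mul_le_mul_of_nonneg_left (hm s') (hγ0 s')).trans
          (mul_le_mul_of_nonneg_right (hγc s') hpos.le)
  nlinarith

/-- Policy Improvement, pointwise form: if
`Σ_a π'(a|s) Q^{π,γ}(s,a) ≥ V^{π,γ}(s)` for every state `s`, then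
`V^{π',γ} ≥ V^{π,γ}` pointwise, and hence for any nonnegative weights `d`,
`Σ_s d(s) V^{π',γ}(s) ≥ Σ_s d(s) V^{π,γ}(s)`. -/
theorem policy_improvement_pointwise
    {S A : Type} [Fintype S] [Fintype A] [Nonempty S] [Nonempty A]
    (P : S → A → S → ℝ) (R : S → A → S → ℝ) (γ : S → ℝ) (c : ℝ)
    (hP0 : ∀ s a s', 0 ≤ P s a s') (hP1 : ∀ s a, ∑ s', P s a s' = 1)
    (hγ0 : ∀ s, 0 ≤ γ s) (hγc : ∀ s, γ s ≤ c) (hc : c < 1)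
    (π π' : S → A → ℝ)
    (hπ0 : ∀ s a, 0 ≤ π s a) (hπ1 : ∀ s, ∑ a, π s a = 1)
    (hπ'0 : ∀ s a, 0 ≤ π' s a) (hπ'1 : ∀ s, ∑ a, π' s a = 1)
    (Vπ Vπ' : S → ℝ)
    (hVπ : ∀ s, Vπ s = ∑ a, π s a * ∑ s', P s a s' * (R s a s' + γ s' * Vπ s'))
    (hVπ' : ∀ s, Vπ' s = ∑ a, π' s a * ∑ s', P s a s' * (R s a s' + γ s' * Vπ' s'))
    (Q : S → A → ℝ)
    (hQ : ∀ s a, Q s a = ∑ s', P s a s' * (R s a s' + γ s' * Vπ s'))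
    (himp : ∀ s, Vπ s ≤ ∑ a, π' s a * Q s a)
    (d : S → ℝ) (hd : ∀ s, 0 ≤ d s) :
    (∀ s, Vπ s ≤ Vπ' s) ∧ ∑ s, d s * Vπ s ≤ ∑ s, d s * Vπ' s := by
  have hle : ∀ s, Vπ s ≤ Vπ' s := fun s => by
    refine sub_nonpos.mp <| nonpos_of_le_discounted_expectation
      (D := fun s => Vπ s - Vπ' s) hP0 hP1 hγ0 hγc hc hπ'0 hπ'1 (fun s => ?_) s
    calc Vπ s - Vπ' s ≤ ∑ a, π' s a * Q s a - Vπ' s := sub_le_sub_right (himp s) _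
      _ = ∑ a, π' s a * ∑ s', P s a s' * (γ s' * (Vπ s' - Vπ' s')) := by
        rw [hVπ' s, ← Finset.sum_sub_distrib]
        refine Finset.sum_congr rfl fun a _ => ?_
        rw [hQ, ← mul_sub, ← Finset.sum_sub_distrib]
        congr 1
        exact Finset.sum_congr rfl fun s' _ => by ring
  exact ⟨hle, Finset.sum_le_sum fun s _ => mul_le_mul_of_nonneg_left (hle s) (hd s)⟩
end

section
/- (Strict policy improvement.) Let S and A be as in the finite MDP setup, let π and π' be policies, V^{π,γ} the unique fixed point of T_π, and Q^{π,γ}(s,a) = Σ_{s'} P(s'|s,a)(R(s,a,s') + γ(s') V^{π,γ}(s')). Suppose Σ_{a} π'(a|s) Q^{π,γ}(s,a) ≥ V^{π,γ}(s) for every s ∈ S, and that this inequality is strict at some state s₀. Then V^{π',γ}(s₀) > V^{π,γ}(s₀); consequently, for any nonnegative weights d : S → ℝ with d(s₀) > 0, Σ_s d(s) V^{π',γ}(s) > Σ_s d(s) V^{π,γ}(s). -/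
/-- Minimum principle: a function dominating its discounted average under a stochastic kernel
is nonnegative. -/
theorem nonneg_of_discounted_average_le {S : Type*} [Fintype S]
    (K : S → S → ℝ) (γ : S → ℝ) (c : ℝ)
    (hK0 : ∀ s s', 0 ≤ K s s') (hK1 : ∀ s, ∑ s', K s s' = 1)
    (hγ0 : ∀ s, 0 ≤ γ s) (hγc : ∀ s, γ s ≤ c) (hc : c < 1)
    (D : S → ℝ) (hD : ∀ s, ∑ s', K s s' * (γ s' * D s') ≤ D s) (s : S) : 0 ≤ D s := by
  have : Nonempty S := ⟨s⟩
  obtain ⟨m, hm⟩ := Finite.exists_min D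
  refine le_trans ?_ (hm s)
  by_contra! hneg
  have hle : c * D m ≤ ∑ s', K m s' * (γ s' * D s') := by
    calc c * D m = ∑ s', K m s' * (c * D m) := by rw [← Finset.sum_mul, hK1, one_mul]
      _ ≤ ∑ s', K m s' * (γ s' * D s') := by
        refine Finset.sum_le_sum fun s' _ => mul_le_mul_of_nonneg_left ?_ (hK0 m s')
        exact (mul_le_mul_of_nonpos_right (hγc s') hneg.le).trans
          (mul_le_mul_of_nonneg_left (hm s') (hγ0 s'))
  nlinarith [hD m]

/-- Strict policy improvement: if `Σ_a π'(a|s) Q^{π,γ}(s,a) ≥ V^{π,γ}(s)`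
for every `s`, with strict inequality at some state `s₀`, then `V^{π',γ}(s₀) > V^{π,γ}(s₀)`;
consequently for nonnegative weights `d` with `d(s₀) > 0` the weighted sums compare strictly. -/
theorem strict_policy_improvement
    {S A : Type} [Fintype S] [Fintype A] [Nonempty S] [Nonempty A]
    (P : S → A → S → ℝ) (R : S → A → S → ℝ) (γ : S → ℝ) (c : ℝ)
    (hP0 : ∀ s a s', 0 ≤ P s a s') (hP1 : ∀ s a, ∑ s', P s a s' = 1)
    (hγ0 : ∀ s, 0 ≤ γ s) (hγc : ∀ s, γ s ≤ c) (hc : c < 1)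
    (π π' : S → A → ℝ)
    (hπ0 : ∀ s a, 0 ≤ π s a) (hπ1 : ∀ s, ∑ a, π s a = 1)
    (hπ'0 : ∀ s a, 0 ≤ π' s a) (hπ'1 : ∀ s, ∑ a, π' s a = 1)
    (Vπ Vπ' : S → ℝ)
    (hVπ : ∀ s, Vπ s = ∑ a, π s a * ∑ s', P s a s' * (R s a s' + γ s' * Vπ s'))
    (hVπ' : ∀ s, Vπ' s = ∑ a, π' s a * ∑ s', P s a s' * (R s a s' + γ s' * Vπ' s'))
    (Q : S → A → ℝ)
    (hQ : ∀ s a, Q s a = ∑ s', P s a s' * (R s a s' + γ s' * Vπ s'))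
    (himp : ∀ s, Vπ s ≤ ∑ a, π' s a * Q s a)
    (s₀ : S) (hstrict : Vπ s₀ < ∑ a, π' s₀ a * Q s₀ a)
    (d : S → ℝ) (hd : ∀ s, 0 ≤ d s) (hd₀ : 0 < d s₀) :
    Vπ s₀ < Vπ' s₀ ∧ ∑ s, d s * Vπ s < ∑ s, d s * Vπ' s := by
  let K : S → S → ℝ := fun s s' => ∑ a, π' s a * P s a s'
  have hK0 : ∀ s s', 0 ≤ K s s' := fun s s' =>
    Finset.sum_nonneg fun a _ => mul_nonneg (hπ'0 s a) (hP0 s a s')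
  have hK1 : ∀ s, ∑ s', K s s' = 1 := fun s => by
    simp only [K]
    rw [Finset.sum_comm]
    simp [← Finset.mul_sum, hP1, hπ'1]
  have hdiff : ∀ s, Vπ' s - ∑ a, π' s a * Q s a
      = ∑ s', K s s' * (γ s' * (Vπ' s' - Vπ s')) := fun s => by
    simp only [K, Finset.sum_mul]
    rw [Finset.sum_comm, hVπ' s, ← Finset.sum_sub_distrib]
    refine Finset.sum_congr rfl fun a _ => ?_
    rw [hQ, ← mul_sub, ← Finset.sum_sub_distrib, Finset.mul_sum]
    exact Finset.sum_congr rfl fun s' _ => by ring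
  have hnonneg : ∀ s, 0 ≤ Vπ' s - Vπ s :=
    nonneg_of_discounted_average_le K γ c hK0 hK1 hγ0 hγc hc (fun s => Vπ' s - Vπ s)
      fun s => by linarith [hdiff s, himp s]
  have hlt : Vπ s₀ < Vπ' s₀ := by
    have : 0 ≤ ∑ s', K s₀ s' * (γ s' * (Vπ' s' - Vπ s')) :=
      Finset.sum_nonneg fun s' _ => mul_nonneg (hK0 _ _) (mul_nonneg (hγ0 _) (hnonneg _))
    linarith [hdiff s₀]
  exact ⟨hlt, Finset.sum_lt_sum
    (fun s _ => mul_le_mul_of_nonneg_left (sub_nonneg.mp (hnonneg s)) (hd s))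
    ⟨s₀, Finset.mem_univ _, mul_lt_mul_of_pos_left hlt hd₀⟩⟩
end

section
/- (Policy Improvement Theorem, tabular parametrization.) Let S and A be as in the finite MDP setup. For each s ∈ S let π_s : ℝ^m → ℝ^A be differentiable at every point, with π_s(θ)(a) ≥ 0 and Σ_a π_s(θ)(a) = 1 for all θ. A parameter u ∈ (S → ℝ^m) induces the policy π_u(a|s) = π_s(u_s)(a). Let V_u denote the unique fixed point of T_{π_u}, Q_u(s,a) = Σ_{s'} P(s'|s,a)(R(s,a,s') + γ(s') V_u(s')), let d : S → ℝ be nonnegative, and define g(u) ∈ (S → ℝ^m) componentwise by g(u)_s = d(s) Σ_a Q_u(s,a) · ∇_θ[π_s(θ)(a)]|_{θ=u_s}. Then there exists ε > 0 such that for all α with 0 < α < ε, the parameter u' = u + α g(u) satisfies V_{u'}(s) ≥ V_u(s) for every s ∈ S, and hence Σ_s d(s) V_{u'}(s) ≥ Σ_s d(s) V_u(s). -/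
open Filter Topology

/-- A small step along a nonnegative multiple of the gradient does not decrease the function. -/
theorem HasGradientAt.eventually_le_add_smul {E : Type*} [NormedAddCommGroup E]
    [InnerProductSpace ℝ E] [CompleteSpace E] {f : E → ℝ} {G x : E} (hf : HasGradientAt f G x)
    {k : ℝ} (hk : 0 ≤ k) : ∀ᶠ α : ℝ in 𝓝[>] 0, f x ≤ f (x + α • k • G) := by
  rcases eq_or_ne (k • G) 0 with h0 | h0
  · simp [h0]
  have hslope : 0 < inner ℝ G (k • G) := by
    rw [smul_ne_zero_iff] at h0
    rw [real_inner_smul_right]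
    exact mul_pos (lt_of_le_of_ne hk h0.1.symm) (real_inner_self_pos.2 h0.2)
  have hd : HasDerivAt (fun α : ℝ => f (x + α • k • G)) (inner ℝ G (k • G)) 0 := by
    have hline : HasDerivAt (fun α : ℝ => x + α • k • G) (k • G) 0 := by
      simpa using ((hasDerivAt_id (0 : ℝ)).smul_const (k • G)).const_add x
    have hf' : HasFDerivAt f (InnerProductSpace.toDual ℝ E G) (x + (0 : ℝ) • k • G) := by
      simpa using hf.hasFDerivAt
    exact hf'.comp_hasDerivAt 0 hline
  filter_upwards [hd.tendsto_slope_zero_right.eventually (lt_mem_nhds hslope),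
    self_mem_nhdsWithin] with α hα hα0
  simp only [zero_add, zero_smul, add_zero, smul_eq_mul] at hα
  have := pos_of_mul_pos_right hα (inv_nonneg.2 (le_of_lt hα0))
  linarith

/-- Finite linear combinations of functions having a gradient. -/
theorem HasGradientAt.sum_mul_const {ι E : Type*} [NormedAddCommGroup E] [InnerProductSpace ℝ E]
    [CompleteSpace E] {s : Finset ι} {f : ι → E → ℝ} {G : ι → E} {x : E}
    (hf : ∀ i ∈ s, HasGradientAt (f i) (G i) x) (q : ι → ℝ) :
    HasGradientAt (fun y => ∑ i ∈ s, f i y * q i) (∑ i ∈ s, q i • G i) x := by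
  rw [hasGradientAt_iff_hasFDerivAt, map_sum]
  refine HasFDerivAt.fun_sum fun i hi => ?_
  simpa using (hf i hi).hasFDerivAt.mul_const (q i)

/-- A function dominating a discounted average of itself is nonnegative. -/
theorem nonneg_of_discounted_average_le_s7 {S A : Type*} [Fintype S] [Fintype A]
    {P : S → A → S → ℝ} {γ : S → ℝ} {c : ℝ} {p : S → A → ℝ}
    (hP0 : ∀ s a s', 0 ≤ P s a s') (hP1 : ∀ s a, ∑ s', P s a s' = 1)
    (hγ0 : ∀ s, 0 ≤ γ s) (hγc : ∀ s, γ s ≤ c) (hc : c < 1)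
    (hp0 : ∀ s a, 0 ≤ p s a) (hp1 : ∀ s, ∑ a, p s a = 1) {W : S → ℝ}
    (hW : ∀ s, ∑ a, p s a * ∑ s', P s a s' * (γ s' * W s') ≤ W s) (s : S) : 0 ≤ W s := by
  have : Nonempty S := ⟨s⟩
  obtain ⟨t, ht⟩ := Finite.exists_min W
  refine le_trans ?_ (ht s)
  by_contra! hneg
  have hpt : ∀ s', c * W t ≤ γ s' * W s' := fun s' =>
    (mul_le_mul_of_nonpos_right (hγc s') hneg.le).trans
      (mul_le_mul_of_nonneg_left (ht s') (hγ0 s'))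
  have key : c * W t ≤ ∑ a, p t a * ∑ s', P t a s' * (γ s' * W s') :=
    calc c * W t = ∑ a, p t a * ∑ s', P t a s' * (c * W t) := by
          simp only [← Finset.sum_mul, hP1, hp1, one_mul]
      _ ≤ _ := Finset.sum_le_sum fun a _ => mul_le_mul_of_nonneg_left
          (Finset.sum_le_sum fun s' _ => mul_le_mul_of_nonneg_left (hpt s') (hP0 t a s'))
          (hp0 t a)
  nlinarith [hW t]


/-- Policy Improvement Theorem, tabular parametrization: with a tabular
policy parametrization `π_u(a|s) = π_s(u_s)(a)` and the approximate-gradient update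
direction `g(u)_s = d(s) Σ_a Q_u(s,a) ∇_θ π_s(θ)(a)|_{θ = u_s}`, there exists `ε > 0`
such that for all `0 < α < ε`, the updated parameter `u' = u + α g(u)` satisfies
`V_{u'}(s) ≥ V_u(s)` for all `s`, and hence `Σ_s d(s) V_{u'}(s) ≥ Σ_s d(s) V_u(s)`. -/
theorem tabular_policy_improvement
    {S A : Type} [Fintype S] [Fintype A] [Nonempty S] [Nonempty A] {m : ℕ}
    (P R : S → A → S → ℝ) (γ : S → ℝ) (c : ℝ)
    (hP0 : ∀ s a s', 0 ≤ P s a s') (hP1 : ∀ s a, ∑ s', P s a s' = 1)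
    (hγ0 : ∀ s, 0 ≤ γ s) (hγc : ∀ s, γ s ≤ c) (hc : c < 1)
    (πs : S → EuclideanSpace ℝ (Fin m) → A → ℝ)
    (hdiff : ∀ s a θ, DifferentiableAt ℝ (fun θ' => πs s θ' a) θ)
    (hpos : ∀ s θ a, 0 ≤ πs s θ a) (hsum : ∀ s θ, ∑ a, πs s θ a = 1)
    (V : (S → EuclideanSpace ℝ (Fin m)) → S → ℝ)
    (hV : ∀ u s, V u s = ∑ a, πs s (u s) a * ∑ s', P s a s' * (R s a s' + γ s' * V u s'))
    (Q : (S → EuclideanSpace ℝ (Fin m)) → S → A → ℝ)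
    (hQ : ∀ u s a, Q u s a = ∑ s', P s a s' * (R s a s' + γ s' * V u s'))
    (d : S → ℝ) (hd : ∀ s, 0 ≤ d s)
    (u : S → EuclideanSpace ℝ (Fin m))
    (g : S → EuclideanSpace ℝ (Fin m))
    (hg : ∀ s, g s = d s • ∑ a, Q u s a • gradient (fun θ => πs s θ a) (u s)) :
    ∃ ε > 0, ∀ α : ℝ, 0 < α → α < ε →
      (∀ s, V u s ≤ V (fun s' => u s' + α • g s') s) ∧
      ∑ s, d s * V u s ≤ ∑ s, d s * V (fun s' => u s' + α • g s') s := by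
  have hstep : ∀ s, ∀ᶠ α : ℝ in 𝓝[>] 0,
      ∑ a, πs s (u s) a * Q u s a ≤ ∑ a, πs s (u s + α • g s) a * Q u s a := fun s => by
    rw [hg s]
    exact (HasGradientAt.sum_mul_const
      (fun a _ => (hdiff s a (u s)).hasGradientAt) (Q u s)).eventually_le_add_smul (hd s)
  obtain ⟨ε, hε, hε'⟩ := mem_nhdsGT_iff_exists_Ioo_subset.1 (eventually_all.2 hstep)
  refine ⟨ε, hε, fun α hα0 hαε => ?_⟩
  have himp := hε' ⟨hα0, hαε⟩
  set u' : S → EuclideanSpace ℝ (Fin m) := fun s' => u s' + α • g s' with hu'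
  have hle : ∀ s, V u s ≤ V u' s := fun s => by
    rw [← sub_nonneg]
    refine nonneg_of_discounted_average_le_s7 (W := fun s => V u' s - V u s) hP0 hP1 hγ0 hγc hc
      (fun s => hpos s (u' s)) (fun s => hsum s (u' s)) (fun s => ?_) s
    have h1 : V u s ≤ ∑ a, πs s (u' s) a * Q u s a := by
      simpa only [hV u s, hQ] using himp s
    have h2 : ∑ a, πs s (u' s) a * ∑ s', P s a s' * (γ s' * (V u' s' - V u s')) =
        V u' s - ∑ a, πs s (u' s) a * Q u s a := by
      rw [hV u' s, ← Finset.sum_sub_distrib]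
      refine Finset.sum_congr rfl fun a _ => ?_
      rw [hQ, ← mul_sub, ← Finset.sum_sub_distrib]
      congr 1
      exact Finset.sum_congr rfl fun s' _ => by ring
    linarith
  exact ⟨hle, Finset.sum_le_sum fun s _ => mul_le_mul_of_nonneg_left (hle s) (hd s)⟩
end

section
/- (Forward–backward view equivalence, finite-horizon form.) Work in the finite off-policy trajectory setup with window distribution μ_n, and fix λ ∈ ℝ, γ : S → ℝ, v : S → ℝ, r : S × A × S → ℝ, and ψ : S × A → ℝ^N. For a trajectory ω = (s_0, a_0, …, a_n, s_{n+1}) define ρ_i = ρ(s_i,a_i), δ_i = r(s_i,a_i,s_{i+1}) + γ(s_{i+1}) v(s_{i+1}) − v(s_i), the truncated off-policy λ-return by the downward recursion G_n = r(s_n,a_n,s_{n+1}) + γ(s_{n+1}) v(s_{n+1}) and G_i = r(s_i,a_i,s_{i+1}) + (1−λ) γ(s_{i+1}) v(s_{i+1}) + λ γ(s_{i+1}) ρ_{i+1} G_{i+1} for 0 ≤ i < n, and the eligibility trace by e_0 = ρ_0 ψ(s_0,a_0) and e_i = ρ_i (ψ(s_i,a_i) + λ γ(s_i) e_{i−1})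 for 1 ≤ i ≤ n. Then Σ_ω μ_n(ω) · ρ_0 (G_0 − v(s_0)) ψ(s_0,a_0) = Σ_ω μ_n(ω) · δ_n e_n, as vectors in ℝ^N. -/
/-- The state sequence `s_0, …, s_{n+1}` of a trajectory `ω ∈ S × (A × S)^{n+1}`. -/
def stSeq {S A : Type} {n : ℕ} (ω : S × (Fin (n + 1) → A × S)) (i : Fin (n + 2)) : S :=
  if h : (i : ℕ) = 0 then ω.1
  else (ω.2 ⟨(i : ℕ) - 1, by have := i.isLt; omega⟩).2

/-- The action sequence `a_0, …, a_n` of a trajectory `ω ∈ S × (A × S)^{n+1}`. -/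
def acSeq {S A : Type} {n : ℕ} (ω : S × (Fin (n + 1) → A × S)) (i : Fin (n + 1)) : A :=
  (ω.2 i).1

/-- The window distribution `μ_n(ω) = d(s_0) ∏_{i=0}^n b(a_i|s_i) P(s_{i+1}|s_i,a_i)`. -/
def muW {S A : Type} [Fintype S] [Fintype A] {n : ℕ}
    (d : S → ℝ) (b : S → A → ℝ) (P : S → A → S → ℝ)
    (ω : S × (Fin (n + 1) → A × S)) : ℝ :=
  d (stSeq ω 0) * ∏ i : Fin (n + 1),
    b (stSeq ω i.castSucc) (acSeq ω i) *
      P (stSeq ω i.castSucc) (acSeq ω i) (stSeq ω i.succ)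

theorem sum_comm_pairs {α β γ δ : Type} [Fintype α] [Fintype β] [Fintype γ] [Fintype δ]
    (F : α → β → γ → δ → ℝ) :
    ∑ a, ∑ b, ∑ c, ∑ d, F a b c d = ∑ c, ∑ d, ∑ a, ∑ b, F a b c d := by
  have h := Finset.sum_comm (s := Finset.univ (α := α × β)) (t := Finset.univ (α := γ × δ))
    (f := fun p q => F p.1 p.2 q.1 q.2)
  simpa only [Fintype.sum_prod_type] using h

section TrajectorySums

variable {S A : Type}

theorem stSeq_cons_zero {n : ℕ} (s : S) (η : Fin (n + 1) → A × S) :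
    stSeq (s, η) 0 = s := rfl

theorem stSeq_cons_succ {n : ℕ} (s : S) (x : A × S) (η : Fin (n + 1) → A × S)
    (i : Fin (n + 2)) :
    stSeq (n := n + 1) (s, Fin.cons x η) i.succ = stSeq (x.2, η) i := by
  cases i using Fin.cases with
  | zero => rfl
  | succ i => rfl

theorem acSeq_cons_succ {n : ℕ} (s : S) (x : A × S) (η : Fin (n + 1) → A × S)
    (i : Fin (n + 1)) :
    acSeq (n := n + 1) (s, Fin.cons x η) i.succ = acSeq (x.2, η) i := rfl

theorem acSeq_cons_zero {n : ℕ} (s : S) (x : A × S) (η : Fin (n + 1) → A × S) :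
    acSeq (n := n + 1) (s, Fin.cons x η) 0 = x.1 := rfl

theorem stSeq_succ {n : ℕ} (ω : S × (Fin (n + 1) → A × S)) (i : Fin (n + 1)) :
    stSeq ω i.succ = (ω.2 i).2 := rfl

theorem stSeq_snoc_castSucc {n : ℕ} (ω : S × (Fin (n + 1) → A × S)) (x : A × S)
    (i : Fin (n + 2)) :
    stSeq (n := n + 1) (ω.1, Fin.snoc ω.2 x) i.castSucc = stSeq ω i := by
  cases i using Fin.cases with
  | zero => rfl
  | succ i =>
    rw [← Fin.succ_castSucc, stSeq_succ, stSeq_succ]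
    simp

theorem acSeq_snoc_castSucc {n : ℕ} (ω : S × (Fin (n + 1) → A × S)) (x : A × S)
    (i : Fin (n + 1)) :
    acSeq (n := n + 1) (ω.1, Fin.snoc ω.2 x) i.castSucc = acSeq ω i := by
  simp [acSeq]

theorem stSeq_snoc_last {n : ℕ} (ω : S × (Fin (n + 1) → A × S)) (x : A × S) :
    stSeq (n := n + 1) (ω.1, Fin.snoc ω.2 x) (Fin.last (n + 1)).succ = x.2 := by
  rw [stSeq_succ]
  simp

theorem acSeq_snoc_last {n : ℕ} (ω : S × (Fin (n + 1) → A × S)) (x : A × S) :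
    acSeq (n := n + 1) (ω.1, Fin.snoc ω.2 x) (Fin.last (n + 1)) = x.1 := by
  simp [acSeq]

variable [Fintype S] [Fintype A]

theorem muW_cons {n : ℕ} (d : S → ℝ) (b : S → A → ℝ) (P : S → A → S → ℝ)
    (s : S) (x : A × S) (η : Fin (n + 1) → A × S) :
    muW (n := n + 1) d b P (s, Fin.cons x η) =
      d s * (b s x.1 * P s x.1 x.2) * muW (fun _ => 1) b P (x.2, η) := by
  simp only [muW]
  rw [Fin.prod_univ_succ]
  simp only [← Fin.succ_castSucc, stSeq_cons_succ, acSeq_cons_succ, one_mul, mul_assoc]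
  rfl

theorem muW_snoc {n : ℕ} (d : S → ℝ) (b : S → A → ℝ) (P : S → A → S → ℝ)
    (ω : S × (Fin (n + 1) → A × S)) (x : A × S) :
    muW (n := n + 1) d b P (ω.1, Fin.snoc ω.2 x) =
      muW d b P ω * (b (stSeq ω (Fin.last n).succ) x.1 *
        P (stSeq ω (Fin.last n).succ) x.1 x.2) := by
  simp only [muW]
  rw [Fin.prod_univ_castSucc, stSeq_snoc_last]
  simp only [Fin.succ_castSucc, stSeq_snoc_castSucc, acSeq_snoc_castSucc, acSeq_snoc_last,
    mul_assoc, Fin.succ_last]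
  rfl

theorem muW_eq_mul {n : ℕ} (d : S → ℝ) (b : S → A → ℝ) (P : S → A → S → ℝ)
    (s : S) (η : Fin (n + 1) → A × S) :
    muW d b P (s, η) = d s * muW (fun _ => 1) b P (s, η) := by
  simp [muW, stSeq_cons_zero]

theorem sum_fin_one_trajectory (F : (Fin 1 → A × S) → ℝ) :
    ∑ η, F η = ∑ a, ∑ s', F (fun _ => (a, s')) := by
  rw [← Fintype.sum_prod_type' (f := fun a s' => F (fun _ => (a, s')))]
  exact ((Equiv.funUnique (Fin 1) (A × S)).symm.sum_comp F).symm

theorem sum_cons_trajectory {n : ℕ} (F : (Fin (n + 1) → A × S) → ℝ) :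
    ∑ η, F η = ∑ a, ∑ s', ∑ η, F (Fin.cons (a, s') η) := by
  rw [← (Fin.consEquiv fun _ => A × S).sum_comp, Fintype.sum_prod_type, Fintype.sum_prod_type]
  rfl

theorem sum_snoc_trajectory {n : ℕ} (F : S × (Fin (n + 1 + 1) → A × S) → ℝ) :
    ∑ ω, F ω = ∑ a, ∑ s', ∑ ω : S × (Fin (n + 1) → A × S), F (ω.1, Fin.snoc ω.2 (a, s')) := by
  have last (s : S) : ∑ ζ, F (s, ζ) =
      ∑ a, ∑ s', ∑ η : Fin (n + 1) → A × S, F (s, Fin.snoc η (a, s')) := by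
    rw [← (Fin.snocEquiv fun _ => A × S).sum_comp, Fintype.sum_prod_type,
      Fintype.sum_prod_type]
    rfl
  rw [Fintype.sum_prod_type]
  simp only [last]
  rw [Finset.sum_comm]
  refine Finset.sum_congr rfl fun a _ => ?_
  rw [Finset.sum_comm]
  exact Finset.sum_congr rfl fun s' _ =>
    (Fintype.sum_prod_type fun ω => F (ω.1, Fin.snoc ω.2 (a, s'))).symm

theorem muW_one_fin_one (b : S → A → ℝ) (P : S → A → S → ℝ) (s s' : S) (a : A) :
    muW (n := 0) (fun _ => 1) b P (s, fun _ => (a, s')) = b s a * P s a s' := by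
  simp [muW, stSeq, acSeq]

theorem sum_muW_one_mul_action (b : S → A → ℝ) (P : S → A → S → ℝ)
    (hP1 : ∀ s a, ∑ s', P s a s' = 1) (hb1 : ∀ s, ∑ a, b s a = 1) (n : ℕ) (s : S)
    (φ : A → ℝ) :
    ∑ η : Fin (n + 1) → A × S, muW (fun _ => 1) b P (s, η) * φ (acSeq (s, η) 0) =
      ∑ a, b s a * φ a := by
  induction n generalizing s φ with
  | zero =>
    rw [sum_fin_one_trajectory]
    refine Finset.sum_congr rfl fun a _ => ?_
    simp only [muW_one_fin_one, acSeq]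
    rw [← Finset.sum_mul, ← Finset.mul_sum, hP1, mul_one]
  | succ n ih =>
    have mass (s' : S) :
        ∑ η : Fin (n + 1) → A × S, muW (fun _ => 1) b P (s', η) = 1 := by
      simpa [hb1] using ih s' fun _ => 1
    rw [sum_cons_trajectory]
    refine Finset.sum_congr rfl fun a _ => ?_
    simp only [muW_cons, acSeq_cons_zero, one_mul, ← Finset.sum_mul, ← Finset.mul_sum, mass,
      mul_one, hP1]

theorem sum_muW_mul_last_state (d : S → ℝ) (b : S → A → ℝ) (P : S → A → S → ℝ)
    (hstat : ∀ s', ∑ s, ∑ a, d s * b s a * P s a s' = d s') (n : ℕ) (g : S → ℝ) :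
    ∑ ω : S × (Fin (n + 1) → A × S), muW d b P ω * g (stSeq ω (Fin.last n).succ) =
      ∑ s, d s * g s := by
  have step (g : S → ℝ) :
      ∑ s, d s * ∑ a, ∑ s', b s a * P s a s' * g s' = ∑ s, d s * g s := by
    have h : ∑ s, d s * g s = ∑ s', ∑ s, ∑ a, d s * b s a * P s a s' * g s' :=
      Finset.sum_congr rfl fun s' _ => by rw [← hstat]; simp only [Finset.sum_mul]
    rw [h, Finset.sum_comm]
    simp only [Finset.mul_sum, mul_assoc]
    exact Finset.sum_congr rfl fun s _ => Finset.sum_comm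
  induction n generalizing g with
  | zero =>
    rw [← step, Fintype.sum_prod_type]
    refine Finset.sum_congr rfl fun s _ => ?_
    rw [sum_fin_one_trajectory]
    simp only [muW_eq_mul d, muW_one_fin_one, stSeq_succ, Finset.mul_sum, mul_assoc]
  | succ n ih =>
    rw [← step, ← ih, sum_snoc_trajectory]
    simp only [muW_snoc, stSeq_snoc_last, Finset.mul_sum]
    conv_rhs => rw [Finset.sum_comm]; enter [2, a]; rw [Finset.sum_comm]
    simp only [mul_assoc]

/-- Backward operator on state-action functions. -/
def traceStep (P : S → A → S → ℝ) (c : S → A → ℝ) (x : S → A → ℝ) : S → A → ℝ :=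
  fun s' a' => c s' a' * ∑ s, ∑ a, P s a s' * x s a

/-- Forward operator on state-action functions, the adjoint of `traceStep`. -/
def returnStep (P : S → A → S → ℝ) (c : S → A → ℝ) (q : S → A → ℝ) : S → A → ℝ :=
  fun s a => ∑ s', P s a s' * ∑ a', c s' a' * q s' a'

theorem sum_returnStep_mul (P : S → A → S → ℝ) (c q x : S → A → ℝ) :
    ∑ s, ∑ a, returnStep P c q s a * x s a = ∑ s, ∑ a, q s a * traceStep P c x s a := by
  have left (s : S) (a : A) : returnStep P c q s a * x s a =
      ∑ s', ∑ a', P s a s' * (c s' a' * q s' a') * x s a := by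
    simp only [returnStep, Finset.mul_sum, Finset.sum_mul]
  have right (s' : S) (a' : A) : q s' a' * traceStep P c x s' a' =
      ∑ s, ∑ a, P s a s' * (c s' a' * q s' a') * x s a := by
    simp only [traceStep, Finset.mul_sum]
    refine Finset.sum_congr rfl fun _ _ => Finset.sum_congr rfl fun _ _ => ?_
    ring
  simp only [left, right]
  exact sum_comm_pairs _

theorem traceStep_add (P : S → A → S → ℝ) (c x y : S → A → ℝ) :
    traceStep P c (x + y) = traceStep P c x + traceStep P c y := by
  funext s a
  simp [traceStep, mul_add, Finset.sum_add_distrib]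

theorem traceStep_iterate (P : S → A → S → ℝ) (c x : S → A → ℝ) (n : ℕ) :
    traceStep P c ((fun y => x + traceStep P c y)^[n] x) =
      (fun y => traceStep P c x + traceStep P c y)^[n] (traceStep P c x) := by
  induction n with
  | zero => rfl
  | succ n ih =>
    rw [Function.iterate_succ_apply', Function.iterate_succ_apply', traceStep_add, ih]

theorem sum_returnStep_iterate_mul (P : S → A → S → ℝ) (c D x : S → A → ℝ) (n : ℕ) :
    ∑ s, ∑ a, (fun q => D + returnStep P c q)^[n] D s a * x s a =
      ∑ s, ∑ a, D s a * (fun y => x + traceStep P c y)^[n] x s a := by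
  induction n generalizing x with
  | zero => rfl
  | succ n ih =>
    rw [Function.iterate_succ_apply', Function.iterate_succ_apply', traceStep_iterate]
    simp only [Pi.add_apply, add_mul, mul_add, Finset.sum_add_distrib, sum_returnStep_mul, ih]

/-- The conditional mean of `δ` given the state-action pair. -/
def tdMean (P : S → A → S → ℝ) (f : S → A → S → ℝ) : S → A → ℝ :=
  fun s a => ∑ s', P s a s' * f s a s'

theorem sum_muW_one_mul_return (P : S → A → S → ℝ) (hP1 : ∀ s a, ∑ s', P s a s' = 1)
    (b : S → A → ℝ) (hb1 : ∀ s, ∑ a, b s a = 1)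
    (ρ : S → A → ℝ) (hρ1 : ∀ s, ∑ a, b s a * ρ s a = 1)
    (lam : ℝ) (γ v : S → ℝ) (r : S → A → S → ℝ) (n : ℕ)
    (G : (S × (Fin (n + 1) → A × S)) → Fin (n + 1) → ℝ)
    (hGlast : ∀ ω, G ω (Fin.last n) =
      r (stSeq ω (Fin.last n).castSucc) (acSeq ω (Fin.last n)) (stSeq ω (Fin.last n).succ)
        + γ (stSeq ω (Fin.last n).succ) * v (stSeq ω (Fin.last n).succ))
    (hGstep : ∀ ω (i : Fin n), G ω i.castSucc =
      r (stSeq ω i.castSucc.castSucc) (acSeq ω i.castSucc) (stSeq ω i.castSucc.succ)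
        + (1 - lam) * γ (stSeq ω i.castSucc.succ) * v (stSeq ω i.castSucc.succ)
        + lam * γ (stSeq ω i.castSucc.succ)
            * ρ (stSeq ω i.succ.castSucc) (acSeq ω i.succ) * G ω i.succ)
    (s : S) (φ : A → ℝ) :
    ∑ η : Fin (n + 1) → A × S,
        muW (fun _ => 1) b P (s, η) * (φ (acSeq (s, η) 0) * (G (s, η) 0 - v s)) =
      ∑ a, b s a * (φ a *
        (fun q => tdMean P (fun s a s' => r s a s' + γ s' * v s' - v s) +
          returnStep P (fun s a => lam * γ s * (b s a * ρ s a)) q)^[n]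
          (tdMean P fun s a s' => r s a s' + γ s' * v s' - v s) s a) := by
  induction n generalizing s φ with
  | zero =>
    rw [sum_fin_one_trajectory]
    refine Finset.sum_congr rfl fun a _ => ?_
    simp only [Function.iterate_zero, id, tdMean, Finset.mul_sum]
    refine Finset.sum_congr rfl fun s' _ => ?_
    have h := hGlast (s, fun _ => (a, s'))
    simp only [stSeq, acSeq, Fin.last_zero, Fin.castSucc_zero, Fin.val_zero, Fin.val_succ,
      dite_true] at h
    rw [muW_one_fin_one, show G (s, fun _ => (a, s')) 0 = _ from h]
    simp [acSeq]
    ring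
  | succ n ih =>
    rw [sum_cons_trajectory]
    refine Finset.sum_congr rfl fun a _ => ?_
    rw [Function.iterate_succ_apply']
    simp only [Pi.add_apply, tdMean, returnStep]
    rw [← Finset.sum_add_distrib, Finset.mul_sum, Finset.mul_sum]
    refine Finset.sum_congr rfl fun s' _ => ?_
    have tail := ih (fun ω i => G (s, Fin.cons (a, ω.1) ω.2) i.succ)
      (fun ω => by
        have h := hGlast (s, Fin.cons (a, ω.1) ω.2)
        rw [← Fin.succ_last, ← Fin.succ_castSucc] at h
        simpa only [stSeq_cons_succ, acSeq_cons_succ] using h)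
      (fun ω i => by
        have h := hGstep (s, Fin.cons (a, ω.1) ω.2) i.succ
        simpa only [← Fin.succ_castSucc, stSeq_cons_succ, acSeq_cons_succ] using h)
      s' (ρ s')
    have mass := sum_muW_one_mul_action b P hP1 hb1 n s' fun _ => 1
    have ratio := sum_muW_one_mul_action b P hP1 hb1 n s' (ρ s')
    rw [hρ1] at ratio
    simp only [mul_one, hb1] at mass
    have head (η : Fin (n + 1) → A × S) : G (s, Fin.cons (a, s') η) 0 =
        r s a s' + (1 - lam) * γ s' * v s' +
          lam * γ s' * ρ s' (acSeq (s', η) 0) * G (s, Fin.cons (a, s') η) (Fin.succ 0) :=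
      hGstep (s, Fin.cons (a, s') η) 0
    have expand (η : Fin (n + 1) → A × S) :
        muW (fun _ => 1) b P (s, (Fin.cons (a, s') η : Fin (n + 2) → A × S)) *
          (φ (acSeq (s, (Fin.cons (a, s') η : Fin (n + 2) → A × S)) 0) *
            (G (s, Fin.cons (a, s') η) 0 - v s)) =
        b s a * φ a * P s a s' * ((r s a s' + γ s' * v s' - v s - lam * γ s' * v s') *
            muW (fun _ => 1) b P (s', η) +
          lam * γ s' * v s' * (muW (fun _ => 1) b P (s', η) * ρ s' (acSeq (s', η) 0)) +
          lam * γ s' * (muW (fun _ => 1) b P (s', η) * (ρ s' (acSeq (s', η) 0) *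
            (G (s, Fin.cons (a, s') η) (Fin.succ 0) - v s')))) := by
      rw [head, muW_cons, acSeq_cons_zero]
      ring
    simp only [expand, ← Finset.mul_sum, Finset.sum_add_distrib, mass, ratio, tail]
    simp only [mul_assoc, ← Finset.mul_sum]
    ring

theorem sum_muW_mul_trace (P : S → A → S → ℝ) (b : S → A → ℝ) (d : S → ℝ)
    (hstat : ∀ s', ∑ s, ∑ a, d s * b s a * P s a s' = d s')
    (ρ : S → A → ℝ) (lam : ℝ) (γ : S → ℝ) (ψ : S → A → ℝ) (n : ℕ)
    (e : (S × (Fin (n + 1) → A × S)) → Fin (n + 1) → ℝ)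
    (he0 : ∀ ω, e ω 0 =
      ρ (stSeq ω ((0 : Fin (n + 1)).castSucc)) (acSeq ω 0) *
        ψ (stSeq ω ((0 : Fin (n + 1)).castSucc)) (acSeq ω 0))
    (hestep : ∀ ω (i : Fin n), e ω i.succ =
      ρ (stSeq ω i.succ.castSucc) (acSeq ω i.succ) *
        (ψ (stSeq ω i.succ.castSucc) (acSeq ω i.succ)
          + (lam * γ (stSeq ω i.succ.castSucc)) * e ω i.castSucc))
    (f : S → A → S → ℝ) :
    ∑ ω : S × (Fin (n + 1) → A × S), muW d b P ω *
        (f (stSeq ω (Fin.last n).castSucc) (acSeq ω (Fin.last n)) (stSeq ω (Fin.last n).succ) *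
          e ω (Fin.last n)) =
      ∑ s, ∑ a, tdMean P f s a *
        (fun y => (fun s a => d s * (b s a * ρ s a) * ψ s a) +
          traceStep P (fun s a => lam * γ s * (b s a * ρ s a)) y)^[n]
          (fun s a => d s * (b s a * ρ s a) * ψ s a) s a := by
  induction n generalizing f with
  | zero =>
    rw [Fintype.sum_prod_type]
    refine Finset.sum_congr rfl fun s _ => ?_
    rw [sum_fin_one_trajectory]
    refine Finset.sum_congr rfl fun a _ => ?_
    simp only [Function.iterate_zero, id, tdMean, Finset.sum_mul]
    refine Finset.sum_congr rfl fun s' _ => ?_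
    have h : e (s, fun _ => (a, s')) 0 = ρ s a * ψ s a := he0 (s, fun _ => (a, s'))
    rw [muW_eq_mul, muW_one_fin_one, Fin.last_zero, h]
    simp [stSeq, acSeq]
    ring
  | succ n ih =>
    rw [Function.iterate_succ_apply', sum_snoc_trajectory]
    simp only [Pi.add_apply, mul_add, Finset.sum_add_distrib, ← sum_returnStep_mul]
    have split (a' : A) (s' : S) :
        ∑ ω : S × (Fin (n + 1) → A × S),
          muW (n := n + 1) d b P (ω.1, Fin.snoc ω.2 (a', s')) *
            (f (stSeq (n := n + 1) (ω.1, Fin.snoc ω.2 (a', s')) (Fin.last (n + 1)).castSucc)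
                (acSeq (n := n + 1) (ω.1, Fin.snoc ω.2 (a', s')) (Fin.last (n + 1)))
                (stSeq (n := n + 1) (ω.1, Fin.snoc ω.2 (a', s')) (Fin.last (n + 1)).succ) *
              e (ω.1, Fin.snoc ω.2 (a', s')) (Fin.last (n + 1))) =
        ∑ s, d s * (b s a' * P s a' s' * f s a' s' * ρ s a' * ψ s a') +
          ∑ s, ∑ a, tdMean P (fun _ _ t => b t a' * P t a' s' * f t a' s' * ρ t a' *
            (lam * γ t)) s a *
          (fun y => (fun s a => d s * (b s a * ρ s a) * ψ s a) +
            traceStep P (fun s a => lam * γ s * (b s a * ρ s a)) y)^[n]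
            (fun s a => d s * (b s a * ρ s a) * ψ s a) s a := by
      rw [← sum_muW_mul_last_state d b P hstat n,
        ← ih (fun ω i => e (ω.1, Fin.snoc ω.2 (a', s')) i.castSucc)
          (fun ω => by
            have h := he0 (ω.1, Fin.snoc ω.2 (a', s'))
            rw [← Fin.castSucc_zero, stSeq_snoc_castSucc, acSeq_snoc_castSucc] at h
            exact h)
          (fun ω i => by
            have h := hestep (ω.1, Fin.snoc ω.2 (a', s')) i.castSucc
            simpa only [Fin.succ_castSucc, stSeq_snoc_castSucc, acSeq_snoc_castSucc] using h),
        ← Finset.sum_add_distrib]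
      refine Finset.sum_congr rfl fun ω _ => ?_
      have h := hestep (ω.1, Fin.snoc ω.2 (a', s')) (Fin.last n)
      rw [Fin.succ_last] at h
      rw [h, muW_snoc, stSeq_snoc_last, acSeq_snoc_last, stSeq_snoc_castSucc, ← Fin.succ_last]
      ring
    have reward : ∑ a', ∑ s', ∑ s, d s * (b s a' * P s a' s' * f s a' s' * ρ s a' * ψ s a') =
        ∑ s, ∑ a, tdMean P f s a * (d s * (b s a * ρ s a) * ψ s a) := by
      rw [Finset.sum_comm (γ := S)]
      refine Finset.sum_congr rfl fun a _ => ?_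
      rw [Finset.sum_comm]
      refine Finset.sum_congr rfl fun s _ => ?_
      rw [tdMean, Finset.sum_mul]
      exact Finset.sum_congr rfl fun s' _ => by ring
    have mean (s : S) (a : A) : ∑ a', ∑ s', tdMean P (fun _ _ t => b t a' * P t a' s' *
          f t a' s' * ρ t a' * (lam * γ t)) s a =
        returnStep P (fun s a => lam * γ s * (b s a * ρ s a)) (tdMean P f) s a := by
      simp only [tdMean, returnStep, Finset.mul_sum]
      rw [Finset.sum_comm (γ := S) (s := Finset.univ (α := S)) (t := Finset.univ (α := A))]
      refine Finset.sum_congr rfl fun a' _ => ?_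
      rw [Finset.sum_comm]
      refine Finset.sum_congr rfl fun t _ => Finset.sum_congr rfl fun s' _ => ?_
      ring
    simp only [split, Finset.sum_add_distrib, reward, ← mean, Finset.sum_mul]
    congr 1
    exact sum_comm_pairs _

end TrajectorySums

/-- Forward–backward view equivalence, finite-horizon form:
with the truncated off-policy λ-return `G` (downward recursion) and the eligibility
trace `e` (forward recursion), the expected forward-view actor update at time `0`
equals the expected backward-view update at time `n`:
`Σ_ω μ_n(ω) ρ_0 (G_0 − v(s_0)) ψ(s_0,a_0) = Σ_ω μ_n(ω) δ_n e_n`. -/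
theorem forward_backward_view_equivalence
    {S A : Type} [Fintype S] [Fintype A] [Nonempty S] [Nonempty A] {n N : ℕ}
    (P : S → A → S → ℝ) (hP0 : ∀ s a s', 0 ≤ P s a s') (hP1 : ∀ s a, ∑ s', P s a s' = 1)
    (b : S → A → ℝ) (hb : ∀ s a, 0 < b s a) (hb1 : ∀ s, ∑ a, b s a = 1)
    (π : S → A → ℝ) (hπ0 : ∀ s a, 0 ≤ π s a) (hπ1 : ∀ s, ∑ a, π s a = 1)
    (d : S → ℝ) (hd : ∀ s, 0 ≤ d s)
    (hstat : ∀ s', ∑ s, ∑ a, d s * b s a * P s a s' = d s')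
    (ρ : S → A → ℝ) (hρ : ∀ s a, ρ s a = π s a / b s a)
    (lam : ℝ) (γ : S → ℝ) (v : S → ℝ) (r : S → A → S → ℝ)
    (ψ : S → A → EuclideanSpace ℝ (Fin N))
    (G : (S × (Fin (n + 1) → A × S)) → Fin (n + 1) → ℝ)
    (hGlast : ∀ ω, G ω (Fin.last n) =
      r (stSeq ω (Fin.last n).castSucc) (acSeq ω (Fin.last n)) (stSeq ω (Fin.last n).succ)
        + γ (stSeq ω (Fin.last n).succ) * v (stSeq ω (Fin.last n).succ))
    (hGstep : ∀ ω (i : Fin n), G ω i.castSucc =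
      r (stSeq ω i.castSucc.castSucc) (acSeq ω i.castSucc) (stSeq ω i.castSucc.succ)
        + (1 - lam) * γ (stSeq ω i.castSucc.succ) * v (stSeq ω i.castSucc.succ)
        + lam * γ (stSeq ω i.castSucc.succ)
            * ρ (stSeq ω i.succ.castSucc) (acSeq ω i.succ) * G ω i.succ)
    (e : (S × (Fin (n + 1) → A × S)) → Fin (n + 1) → EuclideanSpace ℝ (Fin N))
    (he0 : ∀ ω, e ω 0 =
      ρ (stSeq ω ((0 : Fin (n + 1)).castSucc)) (acSeq ω 0) •
        ψ (stSeq ω ((0 : Fin (n + 1)).castSucc)) (acSeq ω 0))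
    (hestep : ∀ ω (i : Fin n), e ω i.succ =
      ρ (stSeq ω i.succ.castSucc) (acSeq ω i.succ) •
        (ψ (stSeq ω i.succ.castSucc) (acSeq ω i.succ)
          + (lam * γ (stSeq ω i.succ.castSucc)) • e ω i.castSucc)) :
    ∑ ω : S × (Fin (n + 1) → A × S),
        (muW d b P ω * ρ (stSeq ω ((0 : Fin (n + 1)).castSucc)) (acSeq ω 0)
          * (G ω 0 - v (stSeq ω ((0 : Fin (n + 1)).castSucc)))) •
          ψ (stSeq ω ((0 : Fin (n + 1)).castSucc)) (acSeq ω 0)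
      = ∑ ω : S × (Fin (n + 1) → A × S),
        (muW d b P ω *
          (r (stSeq ω (Fin.last n).castSucc) (acSeq ω (Fin.last n)) (stSeq ω (Fin.last n).succ)
            + γ (stSeq ω (Fin.last n).succ) * v (stSeq ω (Fin.last n).succ)
            - v (stSeq ω (Fin.last n).castSucc))) • e ω (Fin.last n) := by
  have hρ1 (s : S) : ∑ a, b s a * ρ s a = 1 := by
    rw [← hπ1 s]
    refine Finset.sum_congr rfl fun a _ => ?_
    rw [hρ, mul_div_cancel₀ _ (hb s a).ne']
  ext k
  simp only [WithLp.ofLp_sum, Finset.sum_apply, PiLp.smul_apply, smul_eq_mul]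
  have backward := sum_muW_mul_trace P b d hstat ρ lam γ (fun s a => ψ s a k) n
    (fun ω i => e ω i k) (fun ω => by simp [he0]) (fun ω i => by simp [hestep, mul_add])
    (fun s a s' => r s a s' + γ s' * v s' - v s)
  simp only [mul_assoc] at backward ⊢
  rw [backward]
  simp only [← mul_assoc]
  rw [← sum_returnStep_iterate_mul, Fintype.sum_prod_type]
  refine Finset.sum_congr rfl fun s _ => ?_
  have forward := sum_muW_one_mul_return P hP1 b hb1 ρ hρ1 lam γ v r n G hGlast hGstep s
    fun a => ρ s a * ψ s a k
  trans d s * ∑ η : Fin (n + 1) → A × S, muW (fun _ => 1) b P (s, η) *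
    (ρ s (acSeq (s, η) 0) * ψ s (acSeq (s, η) 0) k * (G (s, η) 0 - v s))
  · rw [Finset.mul_sum]
    refine Finset.sum_congr rfl fun η _ => ?_
    rw [muW_eq_mul, Fin.castSucc_zero, stSeq_cons_zero]
    ring
  · rw [forward, Finset.mul_sum]
    refine Finset.sum_congr rfl fun a _ => ?_
    simp only [mul_assoc]
    ring
end

section
/- (Value function as a matrix inverse and its differentiability in the policy parameters.) Let S and A be as in the finite MDP setup and let u ↦ π_u(a|s) be continuously differentiable on ℝ^N with π_u(a|s) ≥ 0 and Σ_a π_u(a|s) = 1 for all u, s. Define the S × S matrix M(u) by M(u)_{s,s'} = Σ_a π_u(a|s) P(s'|s,a) γ(s') and the vector r̄(u) ∈ ℝ^S by r̄(u)_s = Σ_{a,s'} π_u(a|s) P(s'|s,a) R(s,a,s'). Then: (i) for every u the matrix I − M(u) is invertible; (ii) V_u := (I − M(u))⁻¹ r̄(u), viewed as a function S → ℝ, is the unique fixed point of the Bellman operator T_{π_u}; and (iii) for each s, the map u ↦ V_u(s) is continuously differentiable on ℝ^N. -/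
theorem Matrix.isUnit_one_sub_of_row_sum_lt_one {n : Type*} [Fintype n] [DecidableEq n]
    {A : Matrix n n ℝ} (h0 : ∀ i j, 0 ≤ A i j) (h1 : ∀ i, ∑ j, A i j < 1) :
    IsUnit (1 - A) := by
  rw [Matrix.isUnit_iff_isUnit_det, isUnit_iff_ne_zero]
  refine det_ne_zero_of_sum_row_lt_diag fun k => ?_
  have hsum := Finset.add_sum_erase Finset.univ (A k) (Finset.mem_univ k)
  have hoff : ∑ j ∈ Finset.univ.erase k, ‖(1 - A) k j‖ = ∑ j ∈ Finset.univ.erase k, A k j := by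
    refine Finset.sum_congr rfl fun j hj => ?_
    rw [Matrix.sub_apply, Matrix.one_apply_ne (Finset.ne_of_mem_erase hj).symm, zero_sub,
      norm_neg, Real.norm_of_nonneg (h0 k j)]
  rw [hoff, Matrix.sub_apply, Matrix.one_apply_eq]
  have hk := h1 k
  exact lt_of_lt_of_le (by linarith) (Real.le_norm_self _)

section ContDiff

variable {𝕜 E n : Type*} [NontriviallyNormedField 𝕜] [NormedAddCommGroup E] [NormedSpace 𝕜 E]
  [Fintype n] [DecidableEq n] {k : WithTop ℕ∞} {A : E → Matrix n n 𝕜}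

theorem ContDiff.matrix_det_of_entries (hA : ∀ i j, ContDiff 𝕜 k fun x => A x i j) :
    ContDiff 𝕜 k fun x => (A x).det := by
  simp_rw [Matrix.det_apply']
  exact ContDiff.sum fun σ _ => contDiff_const.mul (contDiff_prod fun i _ => hA _ _)

theorem ContDiff.matrix_inv_apply_of_entries (hA : ∀ i j, ContDiff 𝕜 k fun x => A x i j)
    (hunit : ∀ x, IsUnit (A x)) (i j : n) : ContDiff 𝕜 k fun x => (A x)⁻¹ i j := by
  simp_rw [Matrix.inv_def, Matrix.smul_apply, Matrix.adjugate_apply, Ring.inverse_eq_inv',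
    smul_eq_mul]
  refine ((ContDiff.matrix_det_of_entries hA).inv fun x => ?_).mul
    (ContDiff.matrix_det_of_entries fun a b => ?_)
  · exact ((Matrix.isUnit_iff_isUnit_det _).1 (hunit x)).ne_zero
  · simp_rw [Matrix.updateRow_apply]
    split_ifs
    · exact contDiff_const
    · exact hA a b

end ContDiff

/-- Value function as a matrix inverse and its differentiability:
with `M(u)_{s,s'} = Σ_a π_u(a|s) P(s'|s,a) γ(s')` and
`r̄(u)_s = Σ_{a,s'} π_u(a|s) P(s'|s,a) R(s,a,s')`: (i) `I − M(u)` is invertible for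
every `u`; (ii) `V_u = (I − M(u))⁻¹ r̄(u)` is the unique fixed point of the Bellman
operator `T_{π_u}`; (iii) `u ↦ V_u(s)` is continuously differentiable for each `s`. -/
theorem value_function_matrix_inverse_and_smooth
    {S A : Type} [Fintype S] [Fintype A] [DecidableEq S] [Nonempty S] [Nonempty A] {N : ℕ}
    (P R : S → A → S → ℝ) (γ : S → ℝ) (c : ℝ)
    (hP0 : ∀ s a s', 0 ≤ P s a s') (hP1 : ∀ s a, ∑ s', P s a s' = 1)
    (hγ0 : ∀ s, 0 ≤ γ s) (hγc : ∀ s, γ s ≤ c) (hc : c < 1)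
    (π : EuclideanSpace ℝ (Fin N) → S → A → ℝ)
    (hπdiff : ∀ s a, ContDiff ℝ 1 fun u => π u s a)
    (hπ0 : ∀ u s a, 0 ≤ π u s a) (hπ1 : ∀ u s, ∑ a, π u s a = 1)
    (M : EuclideanSpace ℝ (Fin N) → Matrix S S ℝ)
    (hM : ∀ u s s', M u s s' = ∑ a, π u s a * P s a s' * γ s')
    (rb : EuclideanSpace ℝ (Fin N) → S → ℝ)
    (hrb : ∀ u s, rb u s = ∑ a, ∑ s', π u s a * P s a s' * R s a s')
    (V : EuclideanSpace ℝ (Fin N) → S → ℝ)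
    (hV : ∀ u, V u = Matrix.mulVec (1 - M u)⁻¹ (rb u)) :
    (∀ u, IsUnit (1 - M u)) ∧
    (∀ u,
      (∀ s, V u s = ∑ a, π u s a * ∑ s', P s a s' * (R s a s' + γ s' * V u s')) ∧
      ∀ W : S → ℝ,
        (∀ s, W s = ∑ a, π u s a * ∑ s', P s a s' * (R s a s' + γ s' * W s')) →
        W = V u) ∧
    (∀ s, ContDiff ℝ 1 fun u => V u s) := by
  have hunit : ∀ u, IsUnit (1 - M u) := by
    refine fun u => Matrix.isUnit_one_sub_of_row_sum_lt_one (fun s s' => ?_) fun s => ?_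
    · rw [hM]
      exact Finset.sum_nonneg fun a _ => mul_nonneg (mul_nonneg (hπ0 u s a) (hP0 s a s')) (hγ0 s')
    · calc ∑ s', M u s s' ≤ ∑ s', ∑ a, π u s a * P s a s' * c := by
            simp_rw [hM]
            gcongr with s' _ a _
            · exact mul_nonneg (hπ0 u s a) (hP0 s a s')
            · exact hγc s'
        _ = c := by
            rw [Finset.sum_comm]
            simp_rw [← Finset.sum_mul, ← Finset.mul_sum, hP1, mul_one, hπ1, one_mul]
        _ < 1 := hc
  have hbellman : ∀ u (W : S → ℝ) s,
      ∑ a, π u s a * ∑ s', P s a s' * (R s a s' + γ s' * W s') =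
        rb u s + (M u).mulVec W s := by
    intro u W s
    simp_rw [Matrix.mulVec, dotProduct, hM, hrb, Finset.sum_mul]
    rw [Finset.sum_comm (f := fun s' a => π u s a * P s a s' * γ s' * W s'),
      ← Finset.sum_add_distrib]
    refine Finset.sum_congr rfl fun a _ => ?_
    rw [Finset.mul_sum, ← Finset.sum_add_distrib]
    exact Finset.sum_congr rfl fun s' _ => by ring
  refine ⟨hunit, fun u => ⟨fun s => ?_, fun W hW => ?_⟩, fun s => ?_⟩
  · have hsolve : (1 - M u).mulVec (V u) = rb u := by
      rw [hV, Matrix.mulVec_mulVec,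
        Matrix.mul_nonsing_inv _ ((Matrix.isUnit_iff_isUnit_det _).1 (hunit u)),
        Matrix.one_mulVec]
    rw [Matrix.sub_mulVec, Matrix.one_mulVec] at hsolve
    rw [hbellman, ← hsolve, Pi.sub_apply, sub_add_cancel]
  · have hsolve : (1 - M u).mulVec W = rb u := by
      ext s
      rw [Matrix.sub_mulVec, Matrix.one_mulVec, Pi.sub_apply, sub_eq_iff_eq_add, ← hbellman]
      exact hW s
    rw [hV, ← hsolve, Matrix.mulVec_mulVec,
      Matrix.nonsing_inv_mul _ ((Matrix.isUnit_iff_isUnit_det _).1 (hunit u)),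
      Matrix.one_mulVec]
  · simp_rw [hV, Matrix.mulVec, dotProduct]
    refine ContDiff.sum fun s' _ => ContDiff.mul
      (ContDiff.matrix_inv_apply_of_entries (fun i j => ?_) hunit s s') ?_
    · simp_rw [Matrix.sub_apply, hM]
      exact contDiff_const.sub (ContDiff.sum fun a _ =>
        ((hπdiff i a).mul contDiff_const).mul contDiff_const)
    · simp_rw [hrb]
      exact ContDiff.sum fun a _ => ContDiff.sum fun t _ =>
        ((hπdiff s' a).mul contDiff_const).mul contDiff_const
end

section
/- (Decomposition of the gradient of the off-policy objective.) Let S and A be as in the finite MDP setup, let u ↦ π_u(a|s) be continuously differentiable on ℝ^N with π_u(a|s) ≥ 0 and Σ_a π_u(a|s) = 1 for all u, s, let V_u be the unique fixed point of T_{π_u}, let Q_u(s,a) = Σ_{s'} P(s'|s,a)(R(s,a,s') + γ(s') V_u(s')), let d : S → ℝ, and define the objective J(u) = Σ_s d(s) V_u(s). Then J is continuously differentiable and its gradient satisfies ∇J(u) = Σ_s d(s) Σ_a [ Q_u(s,a) ∇_u π_u(a|s) + π_u(a|s) ∇_u Q_u(s,a) ], where ∇_u Q_u(s,a) = Σ_{s'}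 P(s'|s,a) γ(s') ∇_u V_u(s'). -/
/-- The determinant of a matrix with continuously differentiable entries is continuously
differentiable. -/
theorem ContDiff.matrix_det_of_entries_s17 {E n : Type*} [NormedAddCommGroup E] [NormedSpace ℝ E]
    [Fintype n] [DecidableEq n] {k : WithTop ℕ∞} {B : E → Matrix n n ℝ}
    (hB : ∀ i j, ContDiff ℝ k fun u => B u i j) : ContDiff ℝ k fun u => (B u).det := by
  simp only [Matrix.det_apply']
  exact ContDiff.sum fun σ _ => contDiff_const.mul (contDiff_prod fun i _ => hB _ _)

/-- If a nonnegative matrix has all row sums less than one, then `1 - M` is nonsingular. -/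
theorem Matrix.det_one_sub_ne_zero_of_sum_row_lt_one {n : Type*} [Fintype n] [DecidableEq n]
    {M : Matrix n n ℝ} (h0 : ∀ i j, 0 ≤ M i j) (h1 : ∀ i, ∑ j, M i j < 1) :
    (1 - M).det ≠ 0 := by
  refine det_ne_zero_of_sum_row_lt_diag fun k => ?_
  have hsum : ∑ j ∈ Finset.univ.erase k, ‖(1 - M) k j‖ = ∑ j ∈ Finset.univ.erase k, M k j := by
    refine Finset.sum_congr rfl fun j hj => ?_
    rw [Matrix.sub_apply, Matrix.one_apply_ne (Finset.ne_of_mem_erase hj).symm, zero_sub, norm_neg,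
      Real.norm_of_nonneg (h0 k j)]
  have hsplit := Finset.add_sum_erase Finset.univ (M k) (Finset.mem_univ k)
  rw [hsum, Matrix.sub_apply, Matrix.one_apply_eq]
  exact lt_of_lt_of_le (by linarith [h1 k]) (le_abs_self _)

/-- The solution of a nonsingular linear system with continuously differentiable coefficients is
continuously differentiable. -/
theorem ContDiff.of_mulVec_eq {E n : Type*} [NormedAddCommGroup E] [NormedSpace ℝ E]
    [Fintype n] [DecidableEq n] {k : WithTop ℕ∞} {B : E → Matrix n n ℝ} {r x : E → n → ℝ}
    (hB : ∀ i j, ContDiff ℝ k fun u => B u i j) (hr : ∀ i, ContDiff ℝ k fun u => r u i)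
    (hdet : ∀ u, (B u).det ≠ 0) (hx : ∀ u, (B u).mulVec (x u) = r u) (i : n) :
    ContDiff ℝ k fun u => x u i := by
  have hcramer : ∀ u, x u i = ((B u).updateCol i (r u)).det / (B u).det := fun u => by
    rw [eq_div_iff (hdet u), ← Matrix.cramer_apply, ← hx u, Matrix.cramer_eq_adjugate_mulVec,
      Matrix.mulVec_mulVec, Matrix.adjugate_mul, Matrix.smul_mulVec, Matrix.one_mulVec,
      Pi.smul_apply, smul_eq_mul, mul_comm]
  simp only [hcramer]
  refine (ContDiff.matrix_det_of_entries_s17 fun j l => ?_).div (.matrix_det_of_entries hB) hdet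
  by_cases hl : l = i
  · subst hl
    simpa only [Matrix.updateCol_self] using hr j
  · simpa only [Matrix.updateCol_ne hl] using hB j l

/-- Decomposition of the gradient of the off-policy objective:
the objective `J(u) = Σ_s d(s) V_u(s)` is continuously differentiable and its
gradient decomposes as
`∇J(u) = Σ_s d(s) Σ_a [ Q_u(s,a) ∇π_u(a|s) + π_u(a|s) ∇Q_u(s,a) ]`, where
`∇Q_u(s,a) = Σ_{s'} P(s'|s,a) γ(s') ∇V_u(s')`. -/
theorem off_policy_objective_gradient_decomposition
    {S A : Type} [Fintype S] [Fintype A] [Nonempty S] [Nonempty A] {N : ℕ}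
    (P R : S → A → S → ℝ) (γ : S → ℝ) (c : ℝ)
    (hP0 : ∀ s a s', 0 ≤ P s a s') (hP1 : ∀ s a, ∑ s', P s a s' = 1)
    (hγ0 : ∀ s, 0 ≤ γ s) (hγc : ∀ s, γ s ≤ c) (hc : c < 1)
    (π : EuclideanSpace ℝ (Fin N) → S → A → ℝ)
    (hπdiff : ∀ s a, ContDiff ℝ 1 fun u => π u s a)
    (hπ0 : ∀ u s a, 0 ≤ π u s a) (hπ1 : ∀ u s, ∑ a, π u s a = 1)
    (V : EuclideanSpace ℝ (Fin N) → S → ℝ)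
    (hV : ∀ u s, V u s = ∑ a, π u s a * ∑ s', P s a s' * (R s a s' + γ s' * V u s'))
    (Q : EuclideanSpace ℝ (Fin N) → S → A → ℝ)
    (hQ : ∀ u s a, Q u s a = ∑ s', P s a s' * (R s a s' + γ s' * V u s'))
    (d : S → ℝ)
    (J : EuclideanSpace ℝ (Fin N) → ℝ) (hJ : ∀ u, J u = ∑ s, d s * V u s) :
    (∀ s, ContDiff ℝ 1 fun u => V u s) ∧
    ContDiff ℝ 1 J ∧
    ∀ u, gradient J u =
      ∑ s, d s • ∑ a,
        (Q u s a • gradient (fun u' => π u' s a) u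
          + π u s a • ∑ s', (P s a s' * γ s') • gradient (fun u' => V u' s') u) := by
  classical
  have hVdiff : ∀ s, ContDiff ℝ 1 fun u => V u s := by
    let M : EuclideanSpace ℝ (Fin N) → Matrix S S ℝ :=
      fun u s s' => ∑ a, π u s a * (P s a s' * γ s')
    refine ContDiff.of_mulVec_eq (B := fun u => 1 - M u)
      (r := fun u s => ∑ a, π u s a * ∑ s', P s a s' * R s a s') (fun s s' => ?_) (fun s => ?_)
      (fun u => ?_) (fun u => ?_)
    · exact contDiff_const.sub (ContDiff.sum fun a _ => (hπdiff s a).mul contDiff_const)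
    · exact ContDiff.sum fun a _ => (hπdiff s a).mul contDiff_const
    · refine Matrix.det_one_sub_ne_zero_of_sum_row_lt_one (fun s s' => ?_) (fun s => ?_)
      · exact Finset.sum_nonneg fun a _ =>
          mul_nonneg (hπ0 u s a) (mul_nonneg (hP0 s a s') (hγ0 s'))
      · refine lt_of_le_of_lt ?_ hc
        calc ∑ s', M u s s' = ∑ a, π u s a * ∑ s', P s a s' * γ s' := by
              simp only [M, Finset.mul_sum]
              exact Finset.sum_comm
          _ ≤ ∑ a, π u s a * ∑ s', P s a s' * c := by
              gcongr with a _ s' _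
              · exact hπ0 u s a
              · exact hP0 s a s'
              · exact hγc s'
          _ = c := by simp only [← Finset.sum_mul, hP1, one_mul, hπ1]
    · funext s
      have hMV : (M u).mulVec (V u) s = ∑ a, π u s a * ∑ s', P s a s' * (γ s' * V u s') := by
        simp only [M, Matrix.mulVec, dotProduct, Finset.sum_mul, Finset.mul_sum]
        rw [Finset.sum_comm]
        simp only [mul_assoc]
      rw [Matrix.sub_mulVec, Matrix.one_mulVec, Pi.sub_apply, hMV, hV u s]
      simp only [mul_add, Finset.sum_add_distrib, add_sub_cancel_right]
  have hJV : J = fun u => ∑ s, d s * V u s := funext hJ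
  refine ⟨hVdiff, ?_, fun u => HasGradientAt.gradient ?_⟩
  · rw [hJV]
    exact ContDiff.sum fun s _ => contDiff_const.mul (hVdiff s)
  have hVgrad : ∀ s, HasFDerivAt (fun u' => V u' s)
      (InnerProductSpace.toDual ℝ _ (gradient (fun u' => V u' s) u)) u := fun s =>
    (((hVdiff s).differentiable one_ne_zero) u).hasGradientAt.hasFDerivAt
  have hπgrad : ∀ s a, HasFDerivAt (fun u' => π u' s a)
      (InnerProductSpace.toDual ℝ _ (gradient (fun u' => π u' s a) u)) u := fun s a =>
    (((hπdiff s a).differentiable one_ne_zero) u).hasGradientAt.hasFDerivAt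
  have hJQ : J = fun u => ∑ s, d s * ∑ a, π u s a * Q u s a := by
    funext u
    simp only [hJ, hQ, ← hV]
  have hQgrad : ∀ s a, HasFDerivAt (fun u' => Q u' s a)
      (∑ s', P s a s' • γ s' •
        InnerProductSpace.toDual ℝ _ (gradient (fun u' => V u' s') u)) u := fun s a => by
    simp only [hQ]
    exact HasFDerivAt.fun_sum fun s' _ =>
      (((hVgrad s').const_mul (γ s')).const_add (R s a s')).const_mul (P s a s')
  rw [hasGradientAt_iff_hasFDerivAt, hJQ]
  refine (HasFDerivAt.fun_sum fun s _ => (HasFDerivAt.fun_sum fun a _ =>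
    (hπgrad s a).fun_mul (hQgrad s a)).const_mul (d s)).congr_fderiv ?_
  simp only [map_sum, map_smulₛₗ, map_add, mul_smul, add_comm, conj_trivial]
end
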